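/- Let m be an odd and n an even positive natural number, S and T complex vector spaces, ρ a Clifford multiplication of ℝ^m on S and σ a Clifford multiplication of ℝ^n on T. Let (f_1, …, f_m) be an orthonormal basis of ℝ^m and (w_1, …, w_n) an orthonormal basis of ℝ^n, and let j ∈ {0,1} be such that i^{(m+1)/2} • (ρ(f_1) ∘ … ∘ ρ(f_m)) = (−1)^j • id_S. Set ε := i^{n/2} • (σ(w_1) ∘ … ∘ σ(w_n)) and, for v ∈ ℝ^m, u ∈ ℝ^n, γ(v,u) := ρ(v) ⊗ ε + id_S ⊗ σ(u). Then i^{(m+n+1)/2} • (γ(f_1,0) ∘ … ∘ γ(f_m,0) ∘ γ(0,w_1) ∘ … ∘ γ(0,w_n)) = (−1)^j • id_{S⊗T}. (That is, the induced representation γ sends the complex volume element to (−1)^j times the identity.) -/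

import Mathlib

open TensorProduct

theorem aux_comm {A : Type*} [Ring A] (a : A) (l : List A)
    (h : ∀ b ∈ l, b * a = -(a * b)) : l.prod * a = (-1) ^ l.length * (a * l.prod) := by
  induction l with
  | nil => simp
  | cons b l ih =>
    have h1 := ih (fun c hc => h c (by simp [hc]))
    have h2 := h b (by simp)
    have h3 : b * (-1 : A) ^ l.length = (-1) ^ l.length * b :=
      ((Commute.neg_one_right b).pow_right _).eq
    calc (b :: l).prod * a = b * (l.prod * a) := by simp [mul_assoc]
      _ = (b * (-1 : A) ^ l.length) * (a * l.prod) := by rw [h1, mul_assoc]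
      _ = (-1) ^ l.length * ((b * a) * l.prod) := by rw [h3]; simp only [mul_assoc]
      _ = _ := by rw [h2]; simp [pow_succ, mul_assoc]

theorem aux_sq {A : Type*} [Ring A] (l : List A) (h1 : ∀ b ∈ l, b * b = -1)
    (h : l.Pairwise (fun a b => b * a = -(a * b))) :
    l.prod * l.prod = (-1) ^ ((l.length + 1).choose 2) := by
  induction l with
  | nil => simp
  | cons a l ih =>
    rw [List.pairwise_cons] at h
    have h2 := ih (fun c hc => h1 c (by simp [hc])) h.2
    have h3 := aux_comm a l h.1
    have h4 := h1 a (by simp)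
    have h5 : a * (-1 : A) ^ l.length = (-1) ^ l.length * a :=
      ((Commute.neg_one_right a).pow_right _).eq
    calc (a :: l).prod * (a :: l).prod = a * (l.prod * a) * l.prod := by simp [mul_assoc]
      _ = (a * (-1 : A) ^ l.length) * (a * l.prod) * l.prod := by rw [h3]; simp only [mul_assoc]
      _ = (-1) ^ l.length * ((a * a) * (l.prod * l.prod)) := by rw [h5]; simp only [mul_assoc]
      _ = (-1) ^ (l.length + 1) * (-1) ^ ((l.length + 1).choose 2) := by
        rw [h2, h4, pow_succ, mul_assoc]
      _ = _ := by
        rw [← pow_add, List.length_cons, Nat.choose_succ_succ' (l.length + 1) 1, Nat.choose_one_right]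

theorem aux_mapL {S T ι : Type*} [AddCommGroup S] [Module ℂ S] [AddCommGroup T] [Module ℂ T]
    (g : ι → Module.End ℂ S) (e : Module.End ℂ T) (l : List ι) :
    (l.map (fun i => TensorProduct.map (g i) e : ι → Module.End ℂ (S ⊗[ℂ] T))).prod =
      TensorProduct.map (l.map g).prod (e ^ l.length) := by
  induction l with
  | nil => simp
  | cons a l ih =>
    rw [List.map_cons, List.prod_cons, ih, ← TensorProduct.map_mul, List.map_cons, List.prod_cons,
      List.length_cons, pow_succ']

theorem aux_mapR {S T ι : Type*} [AddCommGroup S] [Module ℂ S] [AddCommGroup T] [Module ℂ T]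
    (g : ι → Module.End ℂ T) (l : List ι) :
    (l.map (fun i => TensorProduct.map (LinearMap.id : S →ₗ[ℂ] S) (g i) :
      ι → Module.End ℂ (S ⊗[ℂ] T))).prod =
      TensorProduct.map (1 : Module.End ℂ S) (l.map g).prod := by
  induction l with
  | nil => simp
  | cons a l ih =>
    rw [List.map_cons, List.prod_cons, ih, List.map_cons, List.prod_cons]
    change TensorProduct.map (1 : Module.End ℂ S) (g a) * _ = _
    rw [← TensorProduct.map_mul, mul_one]

/-- for `m` odd, `n` even and positive, Clifford multiplications `ρ` of
`ℝ^m` on `S` (of type `j`, i.e. sending the complex volume element to `(-1)^j • id`)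
and `σ` of `ℝ^n` on `T`, with `ε = i^(n/2) • (σ (w 1) ∘ ⋯ ∘ σ (w n))` and
`γ (v, u) = ρ v ⊗ ε + id ⊗ σ u`, the representation `γ` sends the complex volume
element to `(-1)^j • id` on `S ⊗ T`. -/
theorem statement10 (m n : ℕ) (hm : Odd m) (hn : Even n) (hn0 : 0 < n)
    (S T : Type*) [AddCommGroup S] [Module ℂ S] [AddCommGroup T] [Module ℂ T]
    (ρ : EuclideanSpace ℝ (Fin m) →ₗ[ℝ] Module.End ℂ S)
    (σ : EuclideanSpace ℝ (Fin n) →ₗ[ℝ] Module.End ℂ T)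
    (hρ : ∀ v, ρ v * ρ v = -((‖v‖ ^ 2 : ℝ) • (1 : Module.End ℂ S)))
    (hσ : ∀ u, σ u * σ u = -((‖u‖ ^ 2 : ℝ) • (1 : Module.End ℂ T)))
    (f : OrthonormalBasis (Fin m) ℝ (EuclideanSpace ℝ (Fin m)))
    (w : OrthonormalBasis (Fin n) ℝ (EuclideanSpace ℝ (Fin n)))
    (j : ℕ) (hj : j = 0 ∨ j = 1)
    (hvolS : Complex.I ^ ((m + 1) / 2) •
        ((List.finRange m).map (fun i => ρ (f i))).prod =
      ((-1 : ℂ) ^ j) • (1 : Module.End ℂ S))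
    (ε : Module.End ℂ T)
    (hε : ε = Complex.I ^ (n / 2) • ((List.finRange n).map (fun k => σ (w k))).prod)
    (γ : EuclideanSpace ℝ (Fin m) → EuclideanSpace ℝ (Fin n) →
      Module.End ℂ (S ⊗[ℂ] T))
    (hγ : ∀ v u, γ v u = TensorProduct.map (ρ v) ε +
      TensorProduct.map (LinearMap.id : S →ₗ[ℂ] S) (σ u)) :
    Complex.I ^ ((m + n + 1) / 2) •
        (((List.finRange m).map (fun i => γ (f i) 0)).prod *
          ((List.finRange n).map (fun k => γ 0 (w k))).prod) =
      ((-1 : ℂ) ^ j) • (1 : Module.End ℂ (S ⊗[ℂ] T)) := by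
  have hsq : ∀ k, σ (w k) * σ (w k) = -1 := fun k => by rw [hσ]; simp
  have hanti : ∀ k l, k ≠ l → σ (w l) * σ (w k) = -(σ (w k) * σ (w l)) := by
    intro k l hkl
    have h := hσ (w k + w l)
    have hn2 : ‖w k + w l‖ ^ 2 = 2 := by
      have := norm_add_sq_real (w k) (w l)
      rw [this, w.orthonormal.2 hkl]
      simp; norm_num
    rw [hn2, map_add, add_mul, mul_add, mul_add, hsq, hsq, two_smul] at h
    rw [eq_neg_iff_add_eq_zero]
    have h' : σ (w l) * σ (w k) + σ (w k) * σ (w l) =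
      (-1 + σ (w k) * σ (w l) + (σ (w l) * σ (w k) + -1)) + (1 + 1) := by abel
    rw [h', h]; abel
  have hP := aux_sq ((List.finRange n).map (fun k => σ (w k)))
    (by intro b hb; obtain ⟨k, -, rfl⟩ := List.mem_map.1 hb; exact hsq k)
    (by
      rw [List.pairwise_map]
      exact (List.nodup_finRange n).imp (fun h => hanti _ _ h))
  rw [List.length_map, List.length_finRange] at hP
  have hee : ε * ε = 1 := by
    obtain ⟨k, rfl⟩ := hn
    have hk : (k + k) / 2 = k := by omega
    have hc : (k + k + 1).choose 2 = k * (2 * k + 1) := by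
      rw [Nat.choose_two_right]
      apply Nat.div_eq_of_eq_mul_left (by norm_num)
      simp only [Nat.add_sub_cancel]; ring
    rw [hε, smul_mul_smul_comm, hP, hk, hc, ← mul_pow, Complex.I_mul_I]
    have h1 : ((-1 : Module.End ℂ T)) ^ (k * (2 * k + 1)) = (-1) ^ k := by
      rw [pow_mul', pow_succ, pow_mul]; simp
    rw [h1]
    rcases Nat.even_or_odd k with h | h
    · simp [h.neg_one_pow]
    · simp [h.neg_one_pow]
  have hγ1 : (fun i => γ (f i) 0) = fun i => TensorProduct.map (ρ (f i)) ε := by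
    funext i; rw [hγ]; simp
  have hγ2 : (fun k => γ 0 (w k)) =
      fun k => TensorProduct.map (LinearMap.id : S →ₗ[ℂ] S) (σ (w k)) := by
    funext i; rw [hγ]; simp
  rw [hγ1, hγ2, aux_mapL (fun i => ρ (f i)), aux_mapR (fun k => σ (w k)), ← TensorProduct.map_mul,
    mul_one, List.length_finRange]
  have hexp : (m + n + 1) / 2 = (m + 1) / 2 + n / 2 := by
    obtain ⟨a, rfl⟩ := hm
    obtain ⟨b, rfl⟩ := hn
    omega
  have hem : ε ^ m * ε = 1 := by
    obtain ⟨a, rfl⟩ := hm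
    rw [← pow_succ, show 2 * a + 1 + 1 = 2 * (a + 1) by ring, pow_mul, pow_two, hee, one_pow]
  rw [hexp, pow_add, mul_smul, ← TensorProduct.map_smul_right, ← mul_smul_comm, ← hε, hem,
    ← TensorProduct.map_smul_left, hvolS, TensorProduct.map_smul_left, TensorProduct.map_one]
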